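/- Let n = 2. There exists K_o > 2, depending only on σ, such that the following holds: for every Φ : [0,∞) → [0,∞) monotone nondecreasing and lower semicontinuous with Φ(t) = 1 for all t ∈ [2, K_o], there exists R_o > 0 such that the pair (ũ, Ẽ) is a minimal pair in B_{R_o}. -/

import Mathlib

open MeasureTheory Filter Set Metric Bornology
open scoped ENNReal Topology symmDiff

noncomputable section

abbrev Pt (n : ℕ) : Type := EuclideanSpace ℝ (Fin n)

/-- The interaction functional `L(A,B) = ∫_A ∫_B |x-y|^{-(n+σ)} dy dx`. -/
def interL (n : ℕ) (σ : ℝ) (A B : Set (Pt n)) : ℝ≥0∞ :=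
  ∫⁻ x in A, ∫⁻ y in B, ENNReal.ofReal (‖x - y‖ ^ (-((n : ℝ) + σ)))

/-- The fractional `σ`-perimeter of `E` in `D`. -/
def fracPer (n : ℕ) (σ : ℝ) (E D : Set (Pt n)) : ℝ≥0∞ :=
  interL n σ (E ∩ D) Eᶜ + interL n σ (Eᶜ ∩ D) (E ∩ Dᶜ)

/-- `u` (locally integrable) has weak gradient `G` on the open set `U`. -/
def HasWeakGradOn (n : ℕ) (u : Pt n → ℝ) (G : Pt n → Pt n) (U : Set (Pt n)) : Prop :=
  LocallyIntegrableOn G U volume ∧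
  ∀ (i : Fin n) (φ : Pt n → ℝ), ContDiff ℝ (⊤ : ℕ∞) φ → HasCompactSupport φ →
    tsupport φ ⊆ U →
    ∫ x, u x * fderiv ℝ φ x (EuclideanSpace.single i 1) = -∫ x, G x i * φ x

/-- The zero-extension (by `0` outside `Ω`) of `w` has a square-integrable weak
gradient on all of `ℝⁿ`. -/
def ZeroExtGradL2 (n : ℕ) (Ω : Set (Pt n)) (w : Pt n → ℝ) : Prop :=
  ∃ H : Pt n → Pt n,
    HasWeakGradOn n (Ω.indicator w) H Set.univ ∧
    Integrable (fun x => ‖H x‖ ^ 2) volume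

/-- An admissible pair `(u,E)` in `Ω`, with `G` a weak gradient of `u` on `Ω`. -/
structure AdmissiblePair (n : ℕ) (σ : ℝ) (Ω : Set (Pt n)) (u : Pt n → ℝ)
    (G : Pt n → Pt n) (E : Set (Pt n)) : Prop where
  locInt : LocallyIntegrable u volume
  weakGrad : HasWeakGradOn n u G Ω
  dirichletFin : IntegrableOn (fun x => ‖G x‖ ^ 2) Ω volume
  measE : MeasurableSet E
  perFin : fracPer n σ E Ω ≠ ∞
  nonnegOnE : ∀ᵐ x ∂(volume : Measure (Pt n)), x ∈ E → 0 ≤ u x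
  nonposOffE : ∀ᵐ x ∂(volume : Measure (Pt n)), x ∉ E → u x ≤ 0

/-- The energy functional `E_Ω(u,E)` (with `G` the weak gradient of `u` on `Ω`). -/
def energyF (n : ℕ) (σ : ℝ) (Φ : ℝ → ℝ) (Ω : Set (Pt n)) (G : Pt n → Pt n)
    (E : Set (Pt n)) : ℝ :=
  (∫ x in Ω, ‖G x‖ ^ 2) + Φ ((fracPer n σ E Ω).toReal)

/-- `(u,E)`, with weak gradient `G`, minimizes the energy in `Ω` among admissible
competitors with the same exterior data. -/
def MinimizesIn (n : ℕ) (σ : ℝ) (Φ : ℝ → ℝ) (Ω : Set (Pt n)) (u : Pt n → ℝ)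
    (G : Pt n → Pt n) (E : Set (Pt n)) : Prop :=
  AdmissiblePair n σ Ω u G E ∧
  ∀ (v : Pt n → ℝ) (Gv : Pt n → Pt n) (F : Set (Pt n)),
    AdmissiblePair n σ Ω v Gv F →
    (∀ᵐ x ∂(volume : Measure (Pt n)), x ∉ Ω → v x = u x) →
    ZeroExtGradL2 n Ω (fun x => v x - u x) →
    volume ((F \ Ω) ∆ (E \ Ω)) = 0 →
    energyF n σ Φ Ω G E ≤ energyF n σ Φ Ω Gv F

/-- `(u,E)` is a minimal pair in `Ω`. -/
def IsMinimalPair (n : ℕ) (σ : ℝ) (Φ : ℝ → ℝ) (Ω : Set (Pt n)) (u : Pt n → ℝ)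
    (E : Set (Pt n)) : Prop :=
  ∃ G : Pt n → Pt n, MinimizesIn n σ Φ Ω u G E

/-- `ũ(x,y) = xy`. -/
def tildeU : Pt 2 → ℝ := fun p => p 0 * p 1

/-- `Ẽ = {(x,y) : xy > 0}`. -/
def tildeE : Set (Pt 2) := {p : Pt 2 | 0 < p 0 * p 1}

/-- `∇ũ(x,y) = (y,x)`. -/
def tildeG : Pt 2 → Pt 2 := fun p => (WithLp.equiv 2 (Fin 2 → ℝ)).symm ![p 1, p 0]

/-- The precise representative `û` of a locally integrable function. -/
def preciseRep (n : ℕ) (u : Pt n → ℝ) (x : Pt n) : ℝ :=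
  limsup (fun ε : ℝ => (volume (ball x ε)).toReal⁻¹ * ∫ y in ball x ε, u y)
    (𝓝[>] (0 : ℝ))

/-- Membership in the set `𝒰₀`. -/
def memU0 (n : ℕ) (Ω : Set (Pt n)) (u : Pt n → ℝ) (p : Pt n) : Prop :=
  p ∈ Ω ∧ ∃ xs : ℕ → Pt n, (∀ k, xs k ∈ Ω) ∧ Tendsto xs atTop (𝓝 p) ∧
    Tendsto (fun k => preciseRep n u (xs k)) atTop (𝓝 (0 : ℝ))

end

/-- The kernel `‖z‖ ^ (-(2 + σ))` integrates to a multiple of `d ^ (-σ)` outside the ball of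
radius `d`. -/
lemma exists_lintegral_tail_le {σ : ℝ} (hσ : 0 < σ) :
    ∃ C : ℝ≥0∞, C ≠ ∞ ∧ ∀ d : ℝ, 0 ≤ d →
      ∫⁻ z in {z : Pt 2 | d ≤ ‖z‖}, ENNReal.ofReal (‖z‖ ^ (-(((2 : ℕ) : ℝ) + σ))) ≤
        C * ENNReal.ofReal d ^ (-σ) := by
  set c : ℝ := 2 * (volume : Measure (Pt 2)).real (ball 0 1) / σ with hc
  have hc0 : 0 ≤ c := by positivity
  refine ⟨ENNReal.ofReal c + 1, by finiteness, fun d hd => ?_⟩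
  rcases hd.eq_or_lt with rfl | hd
  · simp [ENNReal.zero_rpow_of_neg, hσ]
  set f : ℝ → ℝ := (Ici d).indicator fun t => t ^ (-(((2 : ℕ) : ℝ) + σ)) with hf
  have hfi : ∀ y ∈ Ioi (0 : ℝ), y ^ (2 - 1) • f y =
      (Ici d).indicator (fun t : ℝ => t ^ (-1 - σ)) y := by
    intro y hy
    by_cases h : y ∈ Ici d
    · simp only [hf, indicator_of_mem h, Nat.add_one_sub_one, pow_one, smul_eq_mul]
      nth_rw 1 [← Real.rpow_one y]
      rw [← Real.rpow_add hy]
      congr 1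
      push_cast
      ring
    · simp [hf, indicator_of_notMem h]
  have hfin : Module.finrank ℝ (Pt 2) = 2 := by simp
  have hsub : Ioi (0 : ℝ) ∩ Ici d = Ici d :=
    inter_eq_right.2 fun t ht => hd.trans_le ht
  have hint : Integrable (fun z : Pt 2 => f ‖z‖) := by
    rw [integrable_fun_norm_addHaar, hfin, integrableOn_congr_fun hfi measurableSet_Ioi,
      IntegrableOn, integrable_indicator_iff measurableSet_Ici, IntegrableOn,
      Measure.restrict_restrict measurableSet_Ici, inter_comm, hsub, ← IntegrableOn,
      integrableOn_Ici_iff_integrableOn_Ioi]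
    exact integrableOn_Ioi_rpow_of_lt (by linarith) hd
  have hval : ∫ z : Pt 2, f ‖z‖ = c * d ^ (-σ) := by
    rw [integral_fun_norm_addHaar, hfin, setIntegral_congr_fun measurableSet_Ioi hfi,
      setIntegral_indicator measurableSet_Ici, hsub, integral_Ici_eq_integral_Ioi,
      integral_Ioi_rpow_of_lt (by linarith) hd, hc, show -1 - σ + 1 = -σ by ring]
    simp only [smul_eq_mul, nsmul_eq_mul]
    push_cast
    field_simp
  have hset : MeasurableSet {z : Pt 2 | d ≤ ‖z‖} := measurableSet_le measurable_const measurable_norm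
  calc ∫⁻ z in {z : Pt 2 | d ≤ ‖z‖}, ENNReal.ofReal (‖z‖ ^ (-(((2 : ℕ) : ℝ) + σ)))
      = ∫⁻ z : Pt 2, ENNReal.ofReal (f ‖z‖) := by
        rw [← lintegral_indicator hset]
        refine lintegral_congr fun z => ?_
        by_cases h : d ≤ ‖z‖
        · rw [indicator_of_mem (by exact h), hf, indicator_of_mem (by exact h)]
        · rw [indicator_of_notMem (by exact h), hf, indicator_of_notMem (by exact h)]
          simp
    _ = ENNReal.ofReal (c * d ^ (-σ)) := by
        rw [← ofReal_integral_eq_lintegral_ofReal hint, hval]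
        refine Eventually.of_forall fun z => indicator_nonneg (fun t ht => ?_) _
        exact Real.rpow_nonneg (hd.le.trans ht) _
    _ = ENNReal.ofReal c * ENNReal.ofReal d ^ (-σ) := by
        rw [ENNReal.ofReal_mul hc0, ENNReal.ofReal_rpow_of_pos hd]
    _ ≤ _ := by gcongr; exact le_self_add

lemma setLIntegral_abs_rpow_lt_top {σ : ℝ} (hσ : σ < 1) (R : ℝ) :
    ∫⁻ t in ball (0 : ℝ) R, ENNReal.ofReal |t| ^ (-σ) < ∞ := by
  have hint : IntegrableOn (fun t : ℝ => (fun s : ℝ => s ^ (-σ)) ‖t‖) (ball 0 R) := by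
    refine (integrableOn_fun_norm_addHaar volume (f := fun s : ℝ => s ^ (-σ))).2 ?_
    rcases le_or_gt R 0 with hR | hR
    · simp [Ioo_eq_empty_of_le hR]
    · simp only [Module.finrank_self, tsub_self, pow_zero, one_smul]
      exact (intervalIntegral.integrableOn_Ioo_rpow_iff hR).2 (by linarith)
  refine lt_of_le_of_lt (lintegral_mono_ae ?_) hint.2
  filter_upwards [ae_restrict_of_ae (Measure.ae_ne volume (0 : ℝ))] with t ht
  rw [ENNReal.ofReal_rpow_of_pos (abs_pos.2 ht), Real.norm_eq_abs]
  exact Real.ofReal_le_enorm _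

lemma setLIntegral_coord_rpow_lt_top {σ : ℝ} (hσ : σ < 1) (R : ℝ) (i : Fin 2) :
    ∫⁻ x in ball (0 : Pt 2) R, ENNReal.ofReal |x i| ^ (-σ) < ∞ := by
  have hmeas : Measurable fun t : ℝ => ENNReal.ofReal |t| ^ (-σ) := by fun_prop
  set e := (MeasurableEquiv.toLp 2 (Fin 2 → ℝ)).symm
  have he := EuclideanSpace.volume_preserving_symm_measurableEquiv_toLp (Fin 2)
  have hbox : ball (0 : Pt 2) R ⊆ e ⁻¹' (univ.pi fun _ => ball (0 : ℝ) R) := by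
    intro x hx j _
    rw [mem_ball_zero_iff] at hx ⊢
    exact (PiLp.norm_apply_le x j).trans_lt hx
  refine (lintegral_mono_set hbox).trans_lt ?_
  refine (he.setLIntegral_comp_preimage_emb e.measurableEmbedding
    (fun y : Fin 2 → ℝ => ENNReal.ofReal |y i| ^ (-σ)) _).trans_lt ?_
  rw [volume_pi, Measure.restrict_pi_pi,
    ← lintegral_map (μ := Measure.pi fun _ : Fin 2 => volume.restrict (ball (0 : ℝ) R)) hmeas
      (measurable_pi_apply i)]
  rw [show (fun f : Fin 2 → ℝ => f i) = Function.eval i from rfl, Measure.pi_map_eval,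
    lintegral_smul_measure]
  refine ENNReal.mul_lt_top ?_ (setLIntegral_abs_rpow_lt_top hσ R)
  exact ENNReal.prod_lt_top fun j _ =>
    (Measure.restrict_apply_univ _).trans_lt measure_ball_lt_top

lemma interL_lt_top {σ : ℝ} (hσ : σ ∈ Ioo (0 : ℝ) 1) {R : ℝ} {A B : Set (Pt 2)}
    (hA : MeasurableSet A) (hAR : A ⊆ ball 0 R)
    (hAB : ∀ x ∈ A, ∀ y ∈ B, |x 0| ≤ ‖x - y‖ ∨ |x 1| ≤ ‖x - y‖) :
    interL 2 σ A B < ∞ := by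
  obtain ⟨C, hC, hCd⟩ := exists_lintegral_tail_le hσ.1
  set k : Pt 2 → ℝ≥0∞ := fun z => ENNReal.ofReal (‖z‖ ^ (-(((2 : ℕ) : ℝ) + σ))) with hk
  have htail : ∀ (x : Pt 2) (i : Fin 2),
      ∫⁻ y in {y | |x i| ≤ ‖x - y‖}, k (x - y) ≤ C * ENNReal.ofReal |x i| ^ (-σ) := by
    intro x i
    refine le_trans (le_of_eq ?_) (hCd |x i| (abs_nonneg _))
    rw [← lintegral_indicator (measurableSet_le measurable_const (by fun_prop)),
      ← lintegral_indicator (measurableSet_le measurable_const (by fun_prop)),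
      ← lintegral_sub_left_eq_self _ x]
    simp only [indicator, mem_ofPred_eq, sub_sub_cancel, hk]
  have hmeas : ∀ i : Fin 2, Measurable fun x : Pt 2 => ENNReal.ofReal |x i| ^ (-σ) := by
    intro i
    fun_prop
  calc interL 2 σ A B
      ≤ ∫⁻ x in A, (C * ENNReal.ofReal |x 0| ^ (-σ) + C * ENNReal.ofReal |x 1| ^ (-σ)) := by
        refine setLIntegral_mono' hA fun x hx => ?_
        calc ∫⁻ y in B, k (x - y)
            ≤ ∫⁻ y in {y | |x 0| ≤ ‖x - y‖} ∪ {y | |x 1| ≤ ‖x - y‖}, k (x - y) :=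
              lintegral_mono_set fun y hy => hAB x hx y hy
          _ ≤ _ := lintegral_union_le _ _ _
          _ ≤ _ := add_le_add (htail x 0) (htail x 1)
    _ ≤ ∫⁻ x in ball (0 : Pt 2) R,
          (C * ENNReal.ofReal |x 0| ^ (-σ) + C * ENNReal.ofReal |x 1| ^ (-σ)) :=
        lintegral_mono_set hAR
    _ < ∞ := by
        rw [lintegral_add_left ((hmeas 0).const_mul C), lintegral_const_mul _ (hmeas 0),
          lintegral_const_mul _ (hmeas 1)]
        exact ENNReal.add_lt_top.2
          ⟨ENNReal.mul_lt_top hC.lt_top (setLIntegral_coord_rpow_lt_top hσ.2 R 0),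
            ENNReal.mul_lt_top hC.lt_top (setLIntegral_coord_rpow_lt_top hσ.2 R 1)⟩

lemma measurableSet_tildeE : MeasurableSet tildeE :=
  measurableSet_lt measurable_const (by fun_prop)

lemma abs_le_abs_sub_of_mul_nonpos {a b : ℝ} (h : a * b ≤ 0) : |a| ≤ |a - b| := by
  refine sq_le_sq.1 ?_
  nlinarith [sq_nonneg b]

lemma abs_coord_le_norm_sub {x y : Pt 2} (h : (x 0 * x 1) * (y 0 * y 1) ≤ 0) :
    |x 0| ≤ ‖x - y‖ ∨ |x 1| ≤ ‖x - y‖ := by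
  have hcoord : ∀ i : Fin 2, x i * y i ≤ 0 → |x i| ≤ ‖x - y‖ := fun i hi =>
    (abs_le_abs_sub_of_mul_nonpos hi).trans (PiLp.norm_apply_le (x - y) i)
  by_contra! hcon
  have h0 : 0 < x 0 * y 0 := not_le.1 fun h' => hcon.1.not_ge (hcoord 0 h')
  have h1 : 0 < x 1 * y 1 := not_le.1 fun h' => hcon.2.not_ge (hcoord 1 h')
  nlinarith [mul_pos h0 h1]

lemma fracPer_tildeE_ball_ne_top {σ : ℝ} (hσ : σ ∈ Ioo (0 : ℝ) 1) (R : ℝ) :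
    fracPer 2 σ tildeE (ball 0 R) ≠ ∞ := by
  refine (ENNReal.add_lt_top.2 ⟨?_, ?_⟩).ne
  · refine interL_lt_top hσ (measurableSet_tildeE.inter measurableSet_ball) inter_subset_right
      fun x hx y hy => abs_coord_le_norm_sub ?_
    exact mul_nonpos_of_nonneg_of_nonpos (le_of_lt hx.1) (not_lt.1 hy)
  · refine interL_lt_top hσ (measurableSet_tildeE.compl.inter measurableSet_ball)
      inter_subset_right fun x hx y hy => abs_coord_le_norm_sub ?_
    exact mul_nonpos_of_nonpos_of_nonneg (not_lt.1 hx.1) (le_of_lt hy.1)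

lemma mul_volume_le_interL {n : ℕ} {σ D : ℝ} (hσ : 0 < σ) {A B : Set (Pt n)} (hA : MeasurableSet A)
    (hB : MeasurableSet B) (hdisj : Disjoint A B) (hD : ∀ x ∈ A, ∀ y ∈ B, ‖x - y‖ ≤ D) :
    ENNReal.ofReal (D ^ (-((n : ℝ) + σ))) * volume B * volume A ≤ interL n σ A B := by
  rw [← setLIntegral_const]
  refine setLIntegral_mono' hA fun x hx => ?_
  rw [← setLIntegral_const]
  refine setLIntegral_mono' hB fun y hy => ENNReal.ofReal_le_ofReal ?_
  have hpos : 0 < ‖x - y‖ := norm_pos_iff.2 (sub_ne_zero.2 (hdisj.ne_of_mem hx hy))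
  exact Real.rpow_le_rpow_of_nonpos hpos (hD x hx y hy) (neg_nonpos.2 (by positivity))

/-- A ball outside `Ω` lying in one of the two phases of the exterior datum contributes to the
perimeter of every competitor. -/
lemma mul_volume_ball_le_interL {σ : ℝ} (hσ : 0 < σ) {A S : Set (Pt 2)} {p : Pt 2}
    (hA : MeasurableSet A) (hS : MeasurableSet S) (hAB : A ⊆ ball 0 30)
    (hp : 60 ≤ ‖p‖) (hp' : ‖p‖ ≤ 90) (hnull : volume (ball p 30 \ S) = 0) :
    ENNReal.ofReal (150 ^ (-(((2 : ℕ) : ℝ) + σ))) * volume (ball p 30) * volume A ≤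
      interL 2 σ A (S ∩ ball p 30) := by
  have hvol : volume (ball p 30) = volume (S ∩ ball p 30) := by
    rw [inter_comm, ← measure_inter_add_sdiff (ball p 30) hS, hnull, add_zero]
  rw [hvol]
  refine mul_volume_le_interL hσ hA (hS.inter measurableSet_ball) ?_ fun x hx y hy => ?_
  · refine (ball_disjoint_ball (x := (0 : Pt 2)) (y := p) (δ := 30) (ε := 30) ?_).mono hAB
      inter_subset_right
    rw [dist_zero_left]
    linarith
  · have hx' := mem_ball_zero_iff.1 (hAB hx)
    have hy' := mem_ball_iff_norm.1 hy.2
    calc ‖x - y‖ = ‖x - (y - p) - p‖ := by congr 1; abel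
      _ ≤ ‖x‖ + ‖y - p‖ + ‖p‖ := (norm_sub_le _ _).trans (by gcongr; exact norm_sub_le _ _)
      _ ≤ 150 := by linarith

lemma two_le_mul_volume_ball_sq {σ : ℝ} (hσ : σ < 1) (p : Pt 2) :
    2 ≤ ENNReal.ofReal (150 ^ (-(((2 : ℕ) : ℝ) + σ))) * volume (ball p 30) *
      volume (ball (0 : Pt 2) 30) := by
  have hpow : (150 : ℝ) ^ (-3 : ℝ) ≤ 150 ^ (-(((2 : ℕ) : ℝ) + σ)) :=
    Real.rpow_le_rpow_of_exponent_le (by norm_num) (by push_cast; linarith)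
  have hthree : (150 : ℝ) ^ (-3 : ℝ) = (150 ^ 3)⁻¹ := by
    rw [Real.rpow_neg (by norm_num)]
    norm_num
  rw [hthree] at hpow
  have hpi := Real.pi_gt_three
  rw [EuclideanSpace.volume_ball_fin_two, EuclideanSpace.volume_ball_fin_two,
    ← ENNReal.ofReal_pow (by norm_num), ← ENNReal.ofReal_mul (by positivity),
    ← ENNReal.ofReal_mul (by positivity), ← ENNReal.ofReal_mul (by positivity),
    ← ENNReal.ofReal_ofNat]
  refine ENNReal.ofReal_le_ofReal ?_
  calc (2 : ℝ) ≤ (150 ^ 3)⁻¹ * (30 ^ 2 * 3) * (30 ^ 2 * 3) := by norm_num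
    _ ≤ _ := by gcongr

lemma norm_bounds_of_sq_eq {a b : ℝ} (ha : a ^ 2 = 3600) (hb : b ^ 2 = 3600) :
    60 ≤ ‖(!₂[a, b] : Pt 2)‖ ∧ ‖(!₂[a, b] : Pt 2)‖ ≤ 90 := by
  have h : ‖(!₂[a, b] : Pt 2)‖ = √7200 := by
    rw [EuclideanSpace.norm_eq]
    simp only [Fin.sum_univ_two, Real.norm_eq_abs, sq_abs]
    congr 1
    norm_num [ha, hb]
  rw [h]
  constructor
  · exact Real.le_sqrt_of_sq_le (by norm_num)
  · exact Real.sqrt_le_iff.2 (by norm_num)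

lemma two_le_fracPer {σ : ℝ} (hσ : σ ∈ Ioo (0 : ℝ) 1) {F : Set (Pt 2)} (hF : MeasurableSet F)
    (hFE : volume ((F \ ball 0 30) ∆ (tildeE \ ball 0 30)) = 0) :
    2 ≤ fracPer 2 σ F (ball 0 30) := by
  have hcoord : ∀ (a b : ℝ) (y : Pt 2), y ∈ ball !₂[a, b] 30 → |y 0 - a| < 30 ∧ |y 1 - b| < 30 := by
    intro a b y hy
    rw [mem_ball_iff_norm] at hy
    exact ⟨(PiLp.norm_apply_le _ 0).trans_lt hy, (PiLp.norm_apply_le _ 1).trans_lt hy⟩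
  obtain ⟨hq, hq'⟩ := norm_bounds_of_sq_eq (a := 60) (b := 60) (by norm_num) (by norm_num)
  obtain ⟨hp, hp'⟩ := norm_bounds_of_sq_eq (a := 60) (b := -60) (by norm_num) (by norm_num)
  have hout : ∀ p : Pt 2, 60 ≤ ‖p‖ → ∀ y ∈ ball p 30, y ∉ ball (0 : Pt 2) 30 := by
    intro p hp y hy hy0
    refine (ball_disjoint_ball (x := p) (y := (0 : Pt 2)) (δ := 30) (ε := 30) ?_).ne_of_mem hy hy0
      rfl
    rw [dist_zero_right]
    linarith
  have hqE : volume (ball (!₂[60, 60] : Pt 2) 30 \ (F ∩ (ball 0 30)ᶜ)) = 0 := by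
    refine measure_mono_null (fun y hy => ?_) hFE
    have hy0 := hout _ hq y hy.1
    obtain ⟨h0, h1⟩ := hcoord _ _ y hy.1
    rw [abs_lt] at h0 h1
    have hyE : 0 < y 0 * y 1 := mul_pos (by linarith) (by linarith)
    exact Or.inr ⟨⟨hyE, hy0⟩, fun h => hy.2 h⟩
  have hpE : volume (ball (!₂[60, -60] : Pt 2) 30 \ Fᶜ) = 0 := by
    refine measure_mono_null (fun y hy => ?_) hFE
    have hy0 := hout _ hp y hy.1
    obtain ⟨h0, h1⟩ := hcoord _ _ y hy.1
    rw [abs_lt] at h0 h1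
    have hyE : y 0 * y 1 < 0 := mul_neg_of_pos_of_neg (by linarith) (by linarith)
    exact Or.inl ⟨⟨not_not.1 hy.2, hy0⟩, fun h => lt_asymm hyE h.1⟩
  have hmono : ∀ A B C : Set (Pt 2), interL 2 σ A (B ∩ C) ≤ interL 2 σ A B := fun A B C =>
    lintegral_mono fun x => lintegral_mono_set inter_subset_left
  have h1 := (mul_volume_ball_le_interL hσ.1 (hF.inter measurableSet_ball) hF.compl
    inter_subset_right hp hp' hpE).trans (hmono _ _ _)
  have h2 := (mul_volume_ball_le_interL hσ.1 (hF.compl.inter measurableSet_ball)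
    (hF.inter measurableSet_ball.compl) inter_subset_right hq hq' hqE).trans (hmono _ _ _)
  have hV : volume (ball (!₂[60, -60] : Pt 2) 30) = volume (ball (!₂[60, 60] : Pt 2) 30) := by
    simp only [EuclideanSpace.volume_ball_fin_two]
  rw [hV] at h1
  refine (two_le_mul_volume_ball_sq hσ.2 !₂[60, 60]).trans (le_trans ?_ (add_le_add h1 h2))
  rw [← mul_add, inter_comm, inter_comm Fᶜ, ← sdiff_eq, measure_inter_add_sdiff _ hF]

lemma integrable_mul_of_tsupport_subset {n : ℕ} {U : Set (Pt n)} {f φ : Pt n → ℝ}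
    (hf : LocallyIntegrableOn f U) (hφ : Continuous φ) (hφc : HasCompactSupport φ)
    (hφU : tsupport φ ⊆ U) : Integrable fun x => f x * φ x := by
  have h : IntegrableOn (fun x => f x * φ x) (tsupport φ) :=
    (hf.integrableOn_compact_subset hφU hφc).mul_continuousOn hφ.continuousOn hφc
  refine (integrableOn_iff_integrable_of_support_subset fun x hx => ?_).1 h
  exact subset_tsupport φ (right_ne_zero_of_mul hx)

lemma MeasureTheory.LocallyIntegrableOn.euclidean_apply {n : ℕ} {U : Set (Pt n)} {G : Pt n → Pt n}
    (hG : LocallyIntegrableOn G U) (i : Fin n) : LocallyIntegrableOn (fun x => G x i) U := by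
  intro x hx
  obtain ⟨s, hs, hGs⟩ := hG x hx
  exact ⟨s, hs, (EuclideanSpace.proj (𝕜 := ℝ) i).integrable_comp hGs⟩

lemma fderiv_apply_eq_zero_of_notMem_tsupport {n : ℕ} {φ : Pt n → ℝ} {x : Pt n}
    (hx : x ∉ tsupport φ) (v : Pt n) : fderiv ℝ φ x v = 0 := by
  rw [image_eq_zero_of_notMem_tsupport fun h => hx (tsupport_fderiv_subset ℝ h)]
  rfl

namespace HasWeakGradOn

variable {n : ℕ} {u v : Pt n → ℝ} {G G' : Pt n → Pt n} {U V : Set (Pt n)}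

lemma mono (h : HasWeakGradOn n u G V) (hUV : U ⊆ V) : HasWeakGradOn n u G U :=
  ⟨h.1.mono_set hUV, fun i φ hφ hφc hφU => h.2 i φ hφ hφc (hφU.trans hUV)⟩

lemma congr (h : HasWeakGradOn n u G U) (huv : ∀ᵐ x, x ∈ U → u x = v x) :
    HasWeakGradOn n v G U := by
  refine ⟨h.1, fun i φ hφ hφc hφU => ?_⟩
  rw [← h.2 i φ hφ hφc hφU]
  refine integral_congr_ae ?_
  filter_upwards [huv] with x hx
  by_cases hxU : x ∈ tsupport φ
  · rw [hx (hφU hxU)]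
  · rw [fderiv_apply_eq_zero_of_notMem_tsupport hxU, mul_zero, mul_zero]

lemma sub (hu : LocallyIntegrable u) (hv : LocallyIntegrable v) (h : HasWeakGradOn n u G U)
    (h' : HasWeakGradOn n v G' U) :
    HasWeakGradOn n (fun x => u x - v x) (fun x => G x - G' x) U := by
  refine ⟨h.1.sub h'.1, fun i φ hφ hφc hφU => ?_⟩
  have hd : Continuous fun x => fderiv ℝ φ x (EuclideanSpace.single i 1) :=
    (hφ.continuous_fderiv (by simp)).clm_apply continuous_const
  have hdc : HasCompactSupport fun x => fderiv ℝ φ x (EuclideanSpace.single i 1) :=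
    hφc.fderiv_apply ℝ _
  have hdu := integrable_mul_of_tsupport_subset (hu.locallyIntegrableOn univ) hd hdc
    (subset_univ _)
  have hdv := integrable_mul_of_tsupport_subset (hv.locallyIntegrableOn univ) hd hdc
    (subset_univ _)
  have hGφ := integrable_mul_of_tsupport_subset (h.1.euclidean_apply i) hφ.continuous hφc hφU
  have hGφ' := integrable_mul_of_tsupport_subset (h'.1.euclidean_apply i) hφ.continuous hφc hφU
  simp only [PiLp.sub_apply, sub_mul]
  rw [integral_sub hdu hdv, integral_sub hGφ hGφ', h.2 i φ hφ hφc hφU, h'.2 i φ hφ hφc hφU]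
  ring

lemma ae_eq (hU : IsOpen U) (h : HasWeakGradOn n u G U) (h' : HasWeakGradOn n u G' U) :
    ∀ᵐ x, x ∈ U → G x = G' x := by
  have key : ∀ i : Fin n, ∀ᵐ x, x ∈ U → G x i - G' x i = 0 := by
    intro i
    refine hU.ae_eq_zero_of_integral_contDiff_smul_eq_zero
      ((h.1.euclidean_apply i).sub (h'.1.euclidean_apply i)) fun φ hφ hφc hφU => ?_
    have hGφ := integrable_mul_of_tsupport_subset (h.1.euclidean_apply i) hφ.continuous hφc hφU
    have hGφ' := integrable_mul_of_tsupport_subset (h'.1.euclidean_apply i) hφ.continuous hφc hφU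
    calc ∫ x, φ x • (G x i - G' x i) = ∫ x, (G x i * φ x - G' x i * φ x) := by
          refine integral_congr_ae (Eventually.of_forall fun x => ?_)
          simp only [smul_eq_mul]
          ring
      _ = 0 := by
          rw [integral_sub hGφ hGφ']
          linarith [h.2 i φ hφ hφc hφU, h'.2 i φ hφ hφc hφU]
  filter_upwards [ae_all_iff.2 key] with x hx hxU
  ext i
  exact sub_eq_zero.1 (hx i hxU)

lemma zero : HasWeakGradOn n (fun _ => 0) (fun _ => 0) U :=
  ⟨locallyIntegrableOn_zero, fun i φ _ _ _ => by simp⟩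

end HasWeakGradOn

lemma continuous_tildeU : Continuous tildeU := by
  unfold tildeU
  fun_prop

lemma continuous_tildeG : Continuous tildeG :=
  (PiLp.continuous_toLp 2 _).comp (by fun_prop)

lemma hasFDerivAt_tildeU (x : Pt 2) :
    HasFDerivAt tildeU (x 0 • EuclideanSpace.proj (𝕜 := ℝ) (1 : Fin 2) +
      x 1 • EuclideanSpace.proj (𝕜 := ℝ) (0 : Fin 2)) x :=
  (EuclideanSpace.proj (𝕜 := ℝ) (0 : Fin 2)).hasFDerivAt.mul
    (EuclideanSpace.proj (𝕜 := ℝ) (1 : Fin 2)).hasFDerivAt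

lemma fderiv_tildeU_single (x : Pt 2) (i : Fin 2) :
    fderiv ℝ tildeU x (EuclideanSpace.single i 1) = tildeG x i := by
  rw [(hasFDerivAt_tildeU x).fderiv]
  fin_cases i <;> simp [tildeG]

lemma hasWeakGradOn_tildeU (U : Set (Pt 2)) : HasWeakGradOn 2 tildeU tildeG U := by
  refine ⟨continuous_tildeG.locallyIntegrable.locallyIntegrableOn U, fun i φ hφ hφc _ => ?_⟩
  have hG : Continuous fun x => tildeG x i := by
    have := continuous_tildeG
    fun_prop
  have hd : Continuous fun x => fderiv ℝ φ x (EuclideanSpace.single i 1) :=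
    (hφ.continuous_fderiv (by simp)).clm_apply continuous_const
  rw [integral_mul_fderiv_eq_neg_fderiv_mul_of_integrable]
  · simp only [fderiv_tildeU_single]
  · simp only [fderiv_tildeU_single]
    exact (hG.mul hφ.continuous).integrable_of_hasCompactSupport hφc.mul_left
  · exact (continuous_tildeU.mul hd).integrable_of_hasCompactSupport
      (hφc.fderiv_apply ℝ _).mul_left
  · exact (continuous_tildeU.mul hφ.continuous).integrable_of_hasCompactSupport hφc.mul_left
  · exact fun x _ => (hasFDerivAt_tildeU x).differentiableAt
  · exact fun x _ => (hφ.differentiable (by simp)) x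

/-- If `w` vanishes outside a ball, the integral of `xⱼ ∂ᵢw` over the ball vanishes for `i ≠ j`. -/
lemma setIntegral_coord_mul_weakGrad_eq_zero {n : ℕ} {R : ℝ} (hR : 0 < R)
    {w : Pt n → ℝ} {H : Pt n → Pt n} (hH : HasWeakGradOn n ((ball 0 R).indicator w) H univ)
    {i j : Fin n} (hij : i ≠ j) : ∫ x in ball 0 R, H x i * x j = 0 := by
  have : Nontrivial (Pt n) := ⟨⟨EuclideanSpace.single i 1, 0, by simp⟩⟩
  let η : ContDiffBump (0 : Pt n) := ⟨R + 1, R + 2, by linarith, by linarith⟩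
  have hη : ∀ x ∈ closedBall (0 : Pt n) R, (fun y => η y * y j) =ᶠ[𝓝 x] fun y => y j := by
    intro x hx
    have hx' : x ∈ ball (0 : Pt n) (R + 1) := by
      rw [mem_closedBall_zero_iff] at hx
      rw [mem_ball_zero_iff]
      linarith
    filter_upwards [isOpen_ball.mem_nhds hx'] with y hy
    rw [η.one_of_mem_closedBall (ball_subset_closedBall hy), one_mul]
  have hcoord : ContDiff ℝ (⊤ : ℕ∞) fun y : Pt n => y j :=
    (EuclideanSpace.proj (𝕜 := ℝ) j).contDiff
  have hw := hH.2 i (fun y => η y * y j) (η.contDiff.mul hcoord) η.hasCompactSupport.mul_right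
    (subset_univ _)
  have hleft : ∀ x, (ball 0 R).indicator w x *
      fderiv ℝ (fun y => η y * y j) x (EuclideanSpace.single i 1) = 0 := by
    intro x
    by_cases hx : x ∈ ball 0 R
    · rw [(hη x (ball_subset_closedBall hx)).fderiv_eq]
      have : fderiv ℝ (fun y : Pt n => y j) x = EuclideanSpace.proj (𝕜 := ℝ) j :=
        (EuclideanSpace.proj (𝕜 := ℝ) j).fderiv
      rw [this]
      simp [hij.symm]
    · rw [indicator_of_notMem hx, zero_mul]
  have hout : ∀ᵐ x, x ∈ (closedBall (0 : Pt n) R)ᶜ → H x = 0 := by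
    refine HasWeakGradOn.ae_eq isClosed_closedBall.isOpen_compl
      ((hH.mono (subset_univ _)).congr (Eventually.of_forall fun x hx => ?_)) .zero
    exact indicator_of_notMem (fun h => hx (ball_subset_closedBall h)) _
  have hsphere : ∀ᵐ x : Pt n, x ∉ sphere (0 : Pt n) R :=
    measure_eq_zero_iff_ae_notMem.1 (Measure.addHaar_sphere volume 0 R)
  simp only [hleft, integral_zero] at hw
  rw [← integral_indicator measurableSet_ball, ← neg_eq_zero, hw]
  congr 1
  refine integral_congr_ae ?_
  filter_upwards [hout, hsphere] with x hxo hxs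
  by_cases hx : x ∈ ball 0 R
  · rw [indicator_of_mem hx, η.one_of_mem_closedBall, one_mul]
    rw [mem_ball_zero_iff] at hx
    rw [mem_closedBall_zero_iff]
    change _ ≤ R + 1
    linarith
  · rw [indicator_of_notMem hx, hxo, PiLp.zero_apply, zero_mul]
    intro hx'
    rw [← ball_union_sphere] at hx'
    exact hx'.elim hx hxs

lemma tildeU_dirichlet_le {σ R : ℝ} (hR : 0 < R) {v : Pt 2 → ℝ} {Gv : Pt 2 → Pt 2} {F : Set (Pt 2)}
    (hv : AdmissiblePair 2 σ (ball 0 R) v Gv F)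
    (hzero : ZeroExtGradL2 2 (ball 0 R) fun x => v x - tildeU x) :
    ∫ x in ball 0 R, ‖tildeG x‖ ^ 2 ≤ ∫ x in ball 0 R, ‖Gv x‖ ^ 2 := by
  obtain ⟨H, hH, -⟩ := hzero
  have hHG : ∀ᵐ x, x ∈ ball (0 : Pt 2) R → H x = Gv x - tildeG x := by
    refine HasWeakGradOn.ae_eq isOpen_ball ((hH.mono (subset_univ _)).congr
      (Eventually.of_forall fun x hx => indicator_of_mem hx _)) ?_
    exact HasWeakGradOn.sub hv.locInt continuous_tildeU.locallyIntegrable hv.weakGrad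
      (hasWeakGradOn_tildeU _)
  have hint : ∀ i j : Fin 2, IntegrableOn (fun x => H x i * x j) (ball 0 R) := fun i j =>
    (((hH.1.euclidean_apply i).integrableOn_compact_subset (subset_univ _)
      (isCompact_closedBall 0 R)).mul_continuousOn
        (by fun_prop : Continuous fun x : Pt 2 => x j).continuousOn
        (isCompact_closedBall 0 R)).mono_set ball_subset_closedBall
  have hG : IntegrableOn (fun x => ‖tildeG x‖ ^ 2) (ball 0 R) :=
    ((continuous_tildeG.norm.pow 2).continuousOn.integrableOn_compact
      (isCompact_closedBall 0 R)).mono_set ball_subset_closedBall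
  have hcross : IntegrableOn (fun x => 2 * (H x 0 * x 1 + H x 1 * x 0)) (ball 0 R) :=
    ((hint 0 1).add (hint 1 0)).const_mul 2
  have hle : ∫ x in ball 0 R, (‖tildeG x‖ ^ 2 + 2 * (H x 0 * x 1 + H x 1 * x 0)) ≤
      ∫ x in ball 0 R, ‖Gv x‖ ^ 2 := by
    refine integral_mono_ae (hG.add hcross) hv.dirichletFin ?_
    filter_upwards [ae_restrict_of_ae hHG, ae_restrict_mem measurableSet_ball] with x hx hxB
    have h := hx hxB
    have h0 : Gv x 0 = H x 0 + x 1 := by rw [h]; simp [tildeG]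
    have h1 : Gv x 1 = H x 1 + x 0 := by rw [h]; simp [tildeG]
    simp only [EuclideanSpace.norm_sq_eq, Fin.sum_univ_two, Real.norm_eq_abs, sq_abs, h0, h1]
    simp only [tildeG, WithLp.equiv_symm_apply, Matrix.cons_val_zero, Matrix.cons_val_one]
    nlinarith [sq_nonneg (H x 0), sq_nonneg (H x 1)]
  refine le_trans (le_of_eq ?_) hle
  rw [integral_add hG hcross, integral_const_mul, integral_add (hint 0 1) (hint 1 0),
    setIntegral_coord_mul_weakGrad_eq_zero hR hH (by decide),
    setIntegral_coord_mul_weakGrad_eq_zero hR hH (by decide)]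
  simp

lemma admissiblePair_tilde {σ : ℝ} (hσ : σ ∈ Ioo (0 : ℝ) 1) (R : ℝ) :
    AdmissiblePair 2 σ (ball 0 R) tildeU tildeG tildeE where
  locInt := continuous_tildeU.locallyIntegrable
  weakGrad := hasWeakGradOn_tildeU _
  dirichletFin := ((continuous_tildeG.norm.pow 2).continuousOn.integrableOn_compact
    (isCompact_closedBall 0 R)).mono_set ball_subset_closedBall
  measE := measurableSet_tildeE
  perFin := fracPer_tildeE_ball_ne_top hσ R
  nonnegOnE := Eventually.of_forall fun _ hx => le_of_lt hx
  nonposOffE := Eventually.of_forall fun _ hx => not_lt.1 hx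

/-- minimality of `(ũ, Ẽ)` in a large ball (Corollary 3.4). -/
theorem statement2 (σ : ℝ) (hσ : σ ∈ Set.Ioo (0 : ℝ) 1) :
    ∃ K_o : ℝ, 2 < K_o ∧
      ∀ (Φ : ℝ → ℝ),
        MonotoneOn Φ (Set.Ici 0) →
        LowerSemicontinuousOn Φ (Set.Ici 0) →
        (∀ t : ℝ, 0 ≤ t → 0 ≤ Φ t) →
        (∀ t ∈ Set.Icc (2 : ℝ) K_o, Φ t = 1) →
        ∃ R_o : ℝ, 0 < R_o ∧
          IsMinimalPair 2 σ Φ (ball (0 : Pt 2) R_o) tildeU tildeE := by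
  set P : ℝ := (fracPer 2 σ tildeE (ball 0 30)).toReal with hP
  have htwo : ∀ F : Set (Pt 2), MeasurableSet F → fracPer 2 σ F (ball 0 30) ≠ ∞ →
      volume ((F \ ball 0 30) ∆ (tildeE \ ball 0 30)) = 0 →
      2 ≤ (fracPer 2 σ F (ball 0 30)).toReal := fun F hF hFin hFE => by
    simpa using ENNReal.toReal_mono hFin (two_le_fracPer hσ hF hFE)
  refine ⟨max 3 P, lt_max_of_lt_left (by norm_num), fun Φ hmono _ _ hone =>
    ⟨30, by norm_num, tildeG, admissiblePair_tilde hσ 30, fun v Gv F hv _ hzero hFE => ?_⟩⟩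
  have hPE : Φ P = 1 := hone P ⟨htwo tildeE measurableSet_tildeE
    (fracPer_tildeE_ball_ne_top hσ 30) (by simp), le_max_right _ _⟩
  have hPF : 1 ≤ Φ (fracPer 2 σ F (ball 0 30)).toReal := by
    rw [← hone 2 ⟨le_rfl, le_max_of_le_left (by norm_num)⟩]
    exact hmono (mem_Ici.2 zero_le_two) (mem_Ici.2 ENNReal.toReal_nonneg)
      (htwo F hv.measE hv.perFin hFE)
  exact add_le_add (tildeU_dirichlet_le (by norm_num) hv hzero) (hPE.le.trans hPF)
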